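/- Let F be a field and n be a positive integer. A matrix M ∈ GL_n(F) can be written as a product of four U2-matrices of GL_n(F) if and only if det M = 1. -/

import Mathlib

open Module

/-- An endomorphism that is a product of two unipotent endomorphisms of index `2`. -/
def IsProdTwoU2 {R : Type*} [Ring R] (f : R) : Prop :=
  ∃ a b : R, (a - 1) * (a - 1) = 0 ∧ (b - 1) * (b - 1) = 0 ∧ f = a * b

theorem IsProdTwoU2.map {R S : Type*} [Ring R] [Ring S] {f : R} (hf : IsProdTwoU2 f)
    (φ : R →+* S) : IsProdTwoU2 (φ f) := by
  obtain ⟨a, b, ha, hb, rfl⟩ := hf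
  refine ⟨φ a, φ b, ?_, ?_, map_mul φ a b⟩
  · rw [← map_one φ, ← map_sub, ← map_mul, ha, map_zero]
  · rw [← map_one φ, ← map_sub, ← map_mul, hb, map_zero]

section

variable {F V : Type*} [Field F] [AddCommGroup V] [Module F V]

theorem isProdTwoU2_of_isCompl {u v : End F V} (huv : u * v = 1) {E O : Submodule F V}
    (hEO : IsCompl E O) (hE : ∀ e ∈ E, u e - e ∈ O) (hO : ∀ o ∈ O, o - v o ∈ E) :
    IsProdTwoU2 u := by
  set p := E.projection O hEO
  set q := O.projection E hEO.symm
  have hp : ∀ x, p x ∈ E := Submodule.projection_apply_mem hEO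
  have hq : ∀ x, q x ∈ O := Submodule.projection_apply_mem hEO.symm
  have hpE : ∀ x ∈ E, p x = x := fun x hx => Submodule.projection_apply_of_mem_left hEO hx
  have hqE : ∀ x ∈ E, q x = 0 := fun x hx =>
    (Submodule.projection_apply_eq_zero_iff hEO.symm).2 hx
  have hpO : ∀ x ∈ O, p x = 0 := fun x hx => (Submodule.projection_apply_eq_zero_iff hEO).2 hx
  have hqO : ∀ x ∈ O, q x = x := fun x hx => Submodule.projection_apply_of_mem_left hEO.symm hx
  have huv' : ∀ x, u (v x) = x := fun x => congr($huv x)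
  refine ⟨1 + (u - 1) * p, 1 + (1 - v) * q, ?_, ?_, ?_⟩
  · ext x
    simp [hpO _ (hE _ (hp x))]
  · ext x
    simp [hqE _ (hO _ (hq x))]
  · ext x
    have hx : x = p x + q x := (Submodule.projection_add_projection_eq_self hEO x).symm
    have h1 : p (p x) = p x := hpE _ (hp x)
    have h2 : q (p x) = 0 := hqE _ (hp x)
    have h3 : p (q x) = 0 := hpO _ (hq x)
    have h4 : q (q x) = q x := hqO _ (hq x)
    have h5 : p (q x - v (q x)) = q x - v (q x) := hpE _ (hO _ (hq x))
    rw [hx]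
    generalize p x = e at *
    generalize q x = o at *
    have h6 : p (v o) = v o - o := by
      rw [map_sub, h3, zero_sub] at h5
      rw [← neg_neg (p (v o)), h5, neg_sub]
    simp [h1, h2, h3, h4, h6, huv']
    abel

theorem exists_disjoint_sup_eq_of_map (N : End F V) {W E' O' : Submodule F V}
    (hW : W.map N ≤ W) (hdisj : E' ⊓ O' = ⊥) (hsup : E' ⊔ O' = W.map N)
    (hE' : ∀ e ∈ E', N e ∈ O') (hO' : ∀ o ∈ O', ∃ e ∈ E', N o = e + N e) :
    ∃ E O : Submodule F V, E ⊓ O = ⊥ ∧ E ⊔ O = W ∧ (∀ e ∈ E, N e ∈ O) ∧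
      ∀ o ∈ O, ∃ e ∈ E, N o = e + N e := by
  set A := W ⊓ O'.comap N with hA
  set B := W ⊓ (E'.map (1 + N)).comap N with hB
  set K := W ⊓ LinearMap.ker N with hK
  have hE'W : E' ≤ W := (le_sup_left.trans hsup.le).trans hW
  have hO'W : O' ≤ W := (le_sup_right.trans hsup.le).trans hW
  have hKA : K ≤ A := inf_le_inf_left _ fun x hx => by
    rw [LinearMap.mem_ker] at hx; simp [hx]
  have hKB : K ≤ B := inf_le_inf_left _ fun x hx => by
    rw [LinearMap.mem_ker] at hx; simp [hx]
  have hEA : E' ≤ A := le_inf hE'W hE'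
  have hOB : O' ≤ B := le_inf hO'W fun o ho => by
    obtain ⟨e, he, h⟩ := hO' o ho
    exact ⟨e, he, by simp [h]⟩
  have hABK : A ⊓ B ≤ K := by
    rintro x ⟨⟨hxW, hx⟩, -, e, he, hxe⟩
    refine ⟨hxW, ?_⟩
    have hxe : e + N e = N x := by simpa using hxe
    have heO : e ∈ O' := by
      rw [eq_sub_of_add_eq hxe]
      exact O'.sub_mem hx (hE' e he)
    have he0 : e ∈ E' ⊓ O' := ⟨he, heO⟩
    rw [hdisj, Submodule.mem_bot] at he0
    rw [SetLike.mem_coe, LinearMap.mem_ker, ← hxe, he0, map_zero, add_zero]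
  have hABW : W ≤ A ⊔ B := by
    intro x hx
    have hNx : N x ∈ E' ⊔ O' := hsup ▸ Submodule.mem_map_of_mem hx
    obtain ⟨e, he, o, ho, heo⟩ := Submodule.mem_sup.1 hNx
    have h1 : e + N e ∈ W.map N :=
      hsup ▸ add_mem (Submodule.mem_sup_left he) (Submodule.mem_sup_right (hE' e he))
    obtain ⟨b, hb, hbe⟩ := h1
    refine Submodule.mem_sup.2 ⟨x - b, ⟨W.sub_mem hx hb, ?_⟩, b, ⟨hb, e, he, ?_⟩, by simp⟩
    · have : N (x - b) = o - N e := by rw [map_sub, hbe, ← heo]; abel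
      rw [SetLike.mem_coe, Submodule.mem_comap, this]
      exact O'.sub_mem ho (hE' e he)
    · simp [hbe]
  obtain ⟨KE, hKE, hKEsup⟩ := IsModularLattice.exists_inf_eq_and_sup_eq
    (a := E' ⊓ K) (b := (E' ⊓ K) ⊔ (O' ⊓ K)) (c := K) le_sup_left (sup_le inf_le_right inf_le_right)
  set KO := O' ⊓ K with hKO
  have hKEK : KE ≤ K := hKEsup ▸ le_sup_right
  have hE'KE : E' ⊓ K ≤ KE := hKE ▸ inf_le_right
  have hKEO : KE ⊓ KO ≤ ⊥ := by
    have h1 : KE ⊓ KO ≤ E' ⊓ K := hKE ▸ le_inf (inf_le_right.trans le_sup_right) inf_le_left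
    exact hdisj ▸ le_inf (h1.trans inf_le_left) (inf_le_right.trans inf_le_left)
  have hKsup : KE ⊔ KO = K := by
    rw [← hKEsup]
    refine le_antisymm (sup_le le_sup_right (le_sup_right.trans le_sup_left)) ?_
    exact sup_le (sup_le (hE'KE.trans le_sup_left) le_sup_right) le_sup_left
  obtain ⟨E, hE, hEsup⟩ := IsModularLattice.exists_inf_eq_and_sup_eq
    (a := E' ⊔ KE) (b := E' ⊔ KE ⊔ K) (c := A) le_sup_left
    (sup_le (sup_le hEA (hKEK.trans hKA)) hKA)
  obtain ⟨O, hO, hOsup⟩ := IsModularLattice.exists_inf_eq_and_sup_eq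
    (a := O') (b := O' ⊔ K) (c := B) le_sup_left (sup_le hOB hKB)
  have hCE : E' ⊔ KE ≤ E := hE ▸ inf_le_right
  have hO'O : O' ≤ O := hO ▸ inf_le_right
  have hEA' : E ≤ A := hEsup ▸ le_sup_right
  have hOB' : O ≤ B := hOsup ▸ le_sup_right
  have hEK : E ⊓ K ≤ KE := by
    have h1 : E ⊓ K ≤ (KE ⊔ E') ⊓ K := by
      refine le_inf ?_ inf_le_right
      rw [sup_comm, ← hE]
      exact le_inf (inf_le_right.trans le_sup_right) inf_le_left
    rw [sup_inf_assoc_of_le E' hKEK] at h1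
    exact h1.trans (sup_le le_rfl hE'KE)
  have hOK : O ⊓ K ≤ KO := by
    refine le_inf ?_ inf_le_right
    exact (le_inf (inf_le_right.trans le_sup_right) inf_le_left).trans hO.le
  have hKle : K ≤ E ⊔ O := hKsup ▸
    sup_le_sup (le_sup_right.trans hCE) (inf_le_left.trans hO'O)
  refine ⟨E, O, le_bot_iff.1 ?_, le_antisymm ?_ ?_, ?_, ?_⟩
  · have h1 : E ⊓ O ≤ K := (inf_le_inf hEA' hOB').trans hABK
    exact (le_inf ((le_inf inf_le_left h1).trans hEK) ((le_inf inf_le_right h1).trans hOK)).trans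
      hKEO
  · exact sup_le (hEA'.trans inf_le_left) (hOB'.trans inf_le_left)
  · refine hABW.trans (sup_le ?_ ?_)
    · rw [← hEsup]
      exact sup_le (sup_le (hCE.trans le_sup_left) hKle) le_sup_left
    · rw [← hOsup]
      exact sup_le (sup_le (hO'O.trans le_sup_right) hKle) le_sup_right
  · exact fun e he => hO'O (hEA' he).2
  · intro o ho
    obtain ⟨-, e, he, h⟩ := hOB' ho
    exact ⟨e, (le_sup_left.trans hCE) he, by simpa using h.symm⟩

theorem isProdTwoU2_of_isNilpotent {u : End F V} (hu : IsNilpotent (u - 1)) :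
    IsProdTwoU2 u := by
  obtain ⟨N, rfl⟩ : ∃ N, u = 1 + N := ⟨u - 1, by simp⟩
  rw [add_sub_cancel_left] at hu
  obtain ⟨k, hk⟩ := hu
  have key : ∀ j ≤ k, ∃ E O : Submodule F V, E ⊓ O = ⊥ ∧ E ⊔ O = LinearMap.range (N ^ (k - j)) ∧
      (∀ e ∈ E, N e ∈ O) ∧ ∀ o ∈ O, ∃ e ∈ E, N o = e + N e := by
    intro j
    induction j with
    | zero => exact fun _ => ⟨⊥, ⊥, by simp, by simp [hk], by simp, by simp⟩
    | succ j ih =>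
      intro hj
      obtain ⟨E', O', h1, h2, h3, h4⟩ := ih (by omega)
      have hmap : (LinearMap.range (N ^ (k - (j + 1)))).map N = LinearMap.range (N ^ (k - j)) := by
        rw [show k - j = (k - (j + 1)) + 1 by omega, pow_succ', Module.End.mul_eq_comp,
          LinearMap.range_comp]
      refine exists_disjoint_sup_eq_of_map N ?_ h1 (h2.trans hmap.symm) h3 h4
      rw [hmap, show k - j = (k - (j + 1)) + 1 by omega, pow_succ, Module.End.mul_eq_comp]
      exact LinearMap.range_comp_le_range _ _
  obtain ⟨E, O, h1, h2, h3, h4⟩ := key k le_rfl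
  have hunit : IsUnit (1 + N) := IsNilpotent.isUnit_one_add ⟨k, hk⟩
  obtain ⟨v, hv⟩ := hunit.exists_right_inv
  obtain ⟨v', hv'⟩ := hunit.exists_left_inv
  have hvv : v = v' := (left_inv_eq_right_inv hv' hv).symm
  subst hvv
  have hvu : ∀ x, v x + v (N x) = x := fun x => by simpa using congr($hv' x)
  refine isProdTwoU2_of_isCompl hv (E := E) (O := O) ⟨disjoint_iff.2 h1, codisjoint_iff.2 ?_⟩
    (fun e he => by simpa using h3 e he) fun o ho => ?_
  · rw [h2, Nat.sub_self, pow_zero, Module.End.one_eq_id, LinearMap.range_id]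
  · obtain ⟨e, he, h⟩ := h4 o ho
    have h5 : o - v o = e := by
      have h6 := hvu o
      rw [h, map_add, hvu] at h6
      rw [sub_eq_iff_eq_add', h6]
    rwa [h5]

end

section

variable {F Q : Type*} [Field F] [CommRing Q] [Algebra F Q]

theorem isProdTwoU2_mulLeft_of_pow_eq [Module.Finite F Q] {n : ℕ} (hn : 0 < n)
    (hQ : finrank F Q = n) (w : Qˣ) (hw : (w : Q) ^ n = (-1) ^ (n + 1))
    (hgen : ∀ S : Submodule F Q, 1 ∈ S → (∀ x ∈ S, (w : Q) * x ∈ S) →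
      (∀ x ∈ S, (↑w⁻¹ : Q) * x ∈ S) → S = ⊤) :
    IsProdTwoU2 (LinearMap.mulLeft F (w : Q)) := by
  set x : Q := (w : Q)
  set y : Q := ↑w⁻¹
  have hxy : x * y = 1 := w.mul_inv
  have hyx : y * x = 1 := w.inv_mul
  have hxyp : ∀ i : ℕ, x ^ i * y ^ i = 1 := fun i => by rw [← mul_pow, hxy, one_pow]
  let g : ℕ → Q := fun i => if i = 0 then 1 else x ^ i + y ^ i
  let h : ℕ → Q := fun i => x ^ (i + 1) - y ^ i
  set m := n / 2 with hm
  set a := n - m with ha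
  set E : Submodule F Q := Submodule.span F (Set.range fun i : Fin a => g i) with hE
  set O : Submodule F Q := Submodule.span F (Set.range fun i : Fin m => h i) with hO
  have hgE : ∀ i ≤ m, g i ∈ E := by
    intro i hi
    by_cases hia : i < a
    · exact Submodule.subset_span ⟨⟨i, hia⟩, rfl⟩
    · have hnm : n = m + m := by omega
      have him : i = m := by omega
      have hm0 : m ≠ 0 := by omega
      have h1 : x ^ m * x ^ m = -1 := by
        rw [← pow_add, ← hnm, hw, pow_succ, hnm, Even.neg_one_pow ⟨m, rfl⟩, one_mul]
      have h2 : x ^ m + y ^ m = 0 := by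
        linear_combination y ^ m * h1 - x ^ m * hxyp m
      simp [g, him, hm0, h2]
  have hhO : ∀ i < a, h i ∈ O := by
    intro i hi
    by_cases him : i < m
    · exact Submodule.subset_span ⟨⟨i, him⟩, rfl⟩
    · have hnm : n = m + m + 1 := by omega
      have him : i = m := by omega
      have h1 : x ^ m * x ^ (m + 1) = 1 := by
        rw [← pow_add, show m + (m + 1) = n by omega, hw, hnm]
        exact Even.neg_one_pow ⟨m + 1, by omega⟩
      have h2 : x ^ (m + 1) - y ^ m = 0 := by
        linear_combination y ^ m * h1 - x ^ (m + 1) * hxyp m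
      simp [h, him, h2]
  have hEO' : ∀ e ∈ E, x * e - e ∈ O := by
    intro e he
    induction he using Submodule.span_induction with
    | mem z hz =>
      obtain ⟨⟨i, hi⟩, rfl⟩ := hz
      rcases i with _ | i
      · simpa [g, h] using hhO 0 hi
      · have h1 : x * g (i + 1) - g (i + 1) = h (i + 1) - h i := by
          simp only [g, h, Nat.succ_ne_zero, if_false]
          linear_combination y ^ i * hxy
        exact h1 ▸ O.sub_mem (hhO _ hi) (hhO _ (by omega))
    | zero => simp
    | add z z' _ _ hz hz' =>
      have h1 : x * (z + z') - (z + z') = (x * z - z) + (x * z' - z') := by ring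
      exact h1 ▸ O.add_mem hz hz'
    | smul c z _ hz =>
      rw [mul_smul_comm, ← smul_sub]
      exact O.smul_mem c hz
  have hOE' : ∀ o ∈ O, o - y * o ∈ E := by
    intro o ho
    induction ho using Submodule.span_induction with
    | mem z hz =>
      obtain ⟨⟨i, hi⟩, rfl⟩ := hz
      have h1 : h i - y * h i = g (i + 1) - (x ^ i + y ^ i) := by
        simp only [g, h, Nat.succ_ne_zero, if_false]
        linear_combination (-x ^ i) * hxy
      have h2 : x ^ i + y ^ i ∈ E := by
        rcases i with _ | i
        · have := hgE 0 (by omega)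
          simpa [g] using E.add_mem this this
        · simpa [g] using hgE (i + 1) (by omega)
      exact h1 ▸ E.sub_mem (hgE _ hi) h2
    | zero => simp
    | add z z' _ _ hz hz' =>
      have h1 : (z + z') - y * (z + z') = (z - y * z) + (z' - y * z') := by ring
      exact h1 ▸ E.add_mem hz hz'
    | smul c z _ hz =>
      rw [mul_smul_comm, ← smul_sub]
      exact E.smul_mem c hz
  have htop : E ⊔ O = ⊤ := by
    have hxE : ∀ e ∈ E, x * e ∈ E ⊔ O := fun e he => by
      rw [← sub_add_cancel (x * e) e]
      exact add_mem (Submodule.mem_sup_right (hEO' e he)) (Submodule.mem_sup_left he)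
    have hyO : ∀ o ∈ O, y * o ∈ E ⊔ O := fun o ho => by
      rw [← sub_sub_cancel o (y * o)]
      exact sub_mem (Submodule.mem_sup_right ho) (Submodule.mem_sup_left (hOE' o ho))
    refine hgen _ (Submodule.mem_sup_left ?_) (fun z hz => ?_) fun z hz => ?_
    · simpa [g] using hgE 0 (by omega)
    · obtain ⟨e, he, o, ho, rfl⟩ := Submodule.mem_sup.1 hz
      have h1 : x * o = x * (o - y * o) + o := by linear_combination o * hxy
      rw [mul_add, h1]
      exact add_mem (hxE e he) (add_mem (hxE _ (hOE' o ho)) (Submodule.mem_sup_right ho))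
    · obtain ⟨e, he, o, ho, rfl⟩ := Submodule.mem_sup.1 hz
      have h1 : y * e = e - y * (x * e - e) := by linear_combination e * hyx
      rw [mul_add, h1]
      exact add_mem (sub_mem (Submodule.mem_sup_left he) (hyO _ (hEO' e he))) (hyO o ho)
  have hdisj : E ⊓ O = ⊥ := by
    have h1 := Submodule.finrank_sup_add_finrank_inf_eq E O
    have h2 : finrank F E ≤ a := (finrank_range_le_card _).trans (Fintype.card_fin a).le
    have h3 : finrank F O ≤ m := (finrank_range_le_card _).trans (Fintype.card_fin m).le
    rw [htop, finrank_top, hQ] at h1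
    exact Submodule.finrank_eq_zero.1 (by omega)
  refine isProdTwoU2_of_isCompl (v := LinearMap.mulLeft F y) ?_
    ⟨disjoint_iff.2 hdisj, codisjoint_iff.2 htop⟩ hEO' hOE'
  ext z
  simp [← mul_assoc, hxy]

end

theorem exists_smul_one_eq_mul_of_pow_eq_one {F : Type*} [Field F] {n : ℕ} (hn : 0 < n) {c : F}
    (hc : c ^ n = 1) : ∃ A B : Matrix (Fin n) (Fin n) F,
      IsProdTwoU2 A ∧ IsProdTwoU2 B ∧ c • (1 : Matrix (Fin n) (Fin n) F) = A * B := by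
  have hc0 : c ≠ 0 := fun h => by simp [h, hn.ne'] at hc
  set p : Polynomial F := Polynomial.X ^ n - Polynomial.C ((-1) ^ (n + 1)) with hp
  have hmonic : p.Monic := Polynomial.monic_X_pow_sub_C _ hn.ne'
  let Q := AdjoinRoot p
  let pb := AdjoinRoot.powerBasis' hmonic
  have : Module.Finite F Q := pb.finite
  have hQ : finrank F Q = n := by
    rw [pb.finrank, AdjoinRoot.powerBasis'_dim, hp, Polynomial.natDegree_X_pow_sub_C]
  let r : Q := AdjoinRoot.root p
  have hr : r ^ n = (-1) ^ (n + 1) := by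
    have h1 : AdjoinRoot.mk p (Polynomial.X ^ n) = AdjoinRoot.mk p (Polynomial.C ((-1) ^ (n + 1))) :=
      AdjoinRoot.mk_eq_mk.2 dvd_rfl
    rw [map_pow, AdjoinRoot.mk_X, AdjoinRoot.mk_C] at h1
    rw [h1, map_pow, map_neg, map_one]
  have hsq : ((-1 : Q) ^ (n + 1)) * (-1) ^ (n + 1) = 1 := by
    rw [← mul_pow, neg_one_mul, neg_neg, one_pow]
  have hru : IsUnit r := by
    rw [← isUnit_pow_iff hn.ne', hr]
    exact IsUnit.of_mul_eq_one _ hsq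
  obtain ⟨w, hw⟩ := hru
  have hgen : ∀ S : Submodule F Q, 1 ∈ S → (∀ x ∈ S, (w : Q) * x ∈ S) → S = ⊤ := by
    intro S h1 hS
    refine eq_top_iff.2 fun x hx => ?_
    clear hx
    induction x using AdjoinRoot.induction_on with
    | ih q =>
      induction q using Polynomial.induction_on with
      | C c =>
        have : AdjoinRoot.mk p (Polynomial.C c) = c • (1 : Q) := by
          rw [Algebra.smul_def, mul_one]; rfl
        rw [this]
        exact S.smul_mem c h1
      | add q q' hq hq' => exact map_add (AdjoinRoot.mk p) q q' ▸ S.add_mem hq hq'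
      | monomial k c hk =>
        have : AdjoinRoot.mk p (Polynomial.C c * Polynomial.X ^ (k + 1)) =
            (w : Q) * AdjoinRoot.mk p (Polynomial.C c * Polynomial.X ^ k) := by
          rw [hw, show r = AdjoinRoot.mk p Polynomial.X from AdjoinRoot.mk_X.symm, ← map_mul]
          congr 1
          ring
        rw [this]
        exact hS _ hk
  have hwn : (w : Q) ^ n = (-1) ^ (n + 1) := by rw [hw, hr]
  have hinv : ((w⁻¹ : Qˣ) : Q) ^ n = (-1) ^ (n + 1) := by
    have h1 : ((w⁻¹ : Qˣ) : Q) ^ n * (w : Q) ^ n = 1 := by rw [← mul_pow]; simp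
    rw [hwn] at h1
    linear_combination ((-1 : Q) ^ (n + 1)) * h1 - ((w⁻¹ : Qˣ) : Q) ^ n * hsq
  let cu : Qˣ := Units.map (algebraMap F Q).toMonoidHom (Units.mk0 c hc0)
  have hcu : ∀ x : Q, (cu : Q) * x = c • x := fun x => by rw [Algebra.smul_def]; rfl
  have hcun : (cu : Q) ^ n = 1 := by
    change (algebraMap F Q c) ^ n = 1
    rw [← map_pow, hc, map_one]
  have h1 : IsProdTwoU2 (LinearMap.mulLeft F ((w⁻¹ : Qˣ) : Q)) :=
    isProdTwoU2_mulLeft_of_pow_eq hn hQ _ hinv fun S h1 _ h3 => hgen S h1 (by simpa using h3)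
  have h2 : IsProdTwoU2 (LinearMap.mulLeft F ((cu * w : Qˣ) : Q)) := by
    refine isProdTwoU2_mulLeft_of_pow_eq hn hQ _ ?_ fun S h1 h2 _ => hgen S h1 fun x hx => ?_
    · rw [Units.val_mul, mul_pow, hcun, one_mul, hwn]
    · have h3 := S.smul_mem c⁻¹ (h2 x hx)
      rwa [Units.val_mul, mul_assoc, hcu, inv_smul_smul₀ hc0] at h3
  let φ := LinearMap.toMatrixAlgEquiv (finBasisOfFinrankEq F Q hQ)
  refine ⟨φ _, φ _, h1.map φ.toAlgHom.toRingHom, h2.map φ.toAlgHom.toRingHom, ?_⟩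
  rw [← map_mul, ← map_one φ, ← map_smul]
  congr 1
  apply LinearMap.ext
  intro z
  change c • z = ((w⁻¹ : Qˣ) : Q) * (((cu * w : Qˣ) : Q) * z)
  rw [← hcu, Units.val_mul]
  linear_combination (-(cu : Q) * z) * w.inv_mul

/-- An element that is a product of two unipotent elements. -/
def IsProdTwoUnipotent {R : Type*} [Ring R] (f : R) : Prop :=
  ∃ a b : R, IsNilpotent (a - 1) ∧ IsNilpotent (b - 1) ∧ f = a * b

theorem IsProdTwoUnipotent.map {R S : Type*} [Ring R] [Ring S] {f : R}
    (hf : IsProdTwoUnipotent f) (φ : R →+* S) : IsProdTwoUnipotent (φ f) := by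
  obtain ⟨a, b, ha, hb, rfl⟩ := hf
  refine ⟨φ a, φ b, ?_, ?_, map_mul φ a b⟩
  · rw [← map_one φ, ← map_sub]
    exact ha.map φ
  · rw [← map_one φ, ← map_sub]
    exact hb.map φ

section

variable {F W : Type*} [Field F] [AddCommGroup W] [Module F W]

/-- The endomorphism of `F × W` with block matrix `!![1, b; c, D]`. -/
def blockEnd (b : W →ₗ[F] F) (c : W) (D : End F W) : End F (F × W) :=
  (LinearMap.fst F F W + b ∘ₗ LinearMap.snd F F W).prod
    ((LinearMap.fst F F W).smulRight c + D ∘ₗ LinearMap.snd F F W)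

theorem blockEnd_apply (b : W →ₗ[F] F) (c : W) (D : End F W) (x : F × W) :
    blockEnd b c D x = (x.1 + b x.2, x.1 • c + D x.2) := rfl

theorem blockEnd_eq_mul (b : W →ₗ[F] F) (c : W) (A B : End F W) :
    blockEnd b c (A * B + b.smulRight c) = blockEnd 0 c A * blockEnd b 0 B := by
  refine LinearMap.ext fun x => ?_
  simp only [blockEnd_apply, Module.End.mul_apply, Prod.ext_iff]
  simp [add_smul]
  abel

theorem isNilpotent_blockEnd_zero_left_sub_one (c : W) {A : End F W}
    (hA : IsNilpotent (A - 1)) : IsNilpotent (blockEnd 0 c A - 1) := by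
  obtain ⟨k, hk⟩ := hA
  have key : ∀ (j : ℕ) (w : W), ((blockEnd 0 c A - 1) ^ j) (0, w) = (0, ((A - 1) ^ j) w) := by
    intro j
    induction j with
    | zero => simp
    | succ j ih => intro w; simp [pow_succ, blockEnd_apply, ih]
  refine ⟨k + 1, LinearMap.ext fun x => ?_⟩
  have h1 : (blockEnd 0 c A - 1) x = (0, x.1 • c + A x.2 - x.2) := by
    ext <;> simp [blockEnd_apply]
  rw [pow_succ, Module.End.mul_apply, h1, key, hk]
  rfl

theorem isNilpotent_blockEnd_zero_right_sub_one (b : W →ₗ[F] F) {B : End F W}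
    (hB : IsNilpotent (B - 1)) : IsNilpotent (blockEnd b 0 B - 1) := by
  obtain ⟨k, hk⟩ := hB
  have key : ∀ (j : ℕ) (x : F × W), (((blockEnd b 0 B - 1) ^ j) x).2 = ((B - 1) ^ j) x.2 := by
    intro j
    induction j with
    | zero => simp
    | succ j ih => intro x; simp [pow_succ, blockEnd_apply, ih]
  refine ⟨k + 1, LinearMap.ext fun x => ?_⟩
  have h2 := key k x
  rw [hk] at h2
  rw [pow_succ', Module.End.mul_apply]
  ext <;> simp [blockEnd_apply, h2]

theorem isProdTwoUnipotent_blockEnd {b : W →ₗ[F] F} {c : W} {D : End F W}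
    (h : IsProdTwoUnipotent (D - b.smulRight c)) : IsProdTwoUnipotent (blockEnd b c D) := by
  obtain ⟨A, B, hA, hB, hAB⟩ := h
  refine ⟨_, _, isNilpotent_blockEnd_zero_left_sub_one c hA,
    isNilpotent_blockEnd_zero_right_sub_one b hB, ?_⟩
  rw [← blockEnd_eq_mul, ← hAB, sub_add_cancel]

theorem det_blockEnd [FiniteDimensional F W] (b : W →ₗ[F] F) (c : W) (D : End F W) :
    (blockEnd b c D).det = (D - b.smulRight c).det := by
  have h1 : blockEnd b c D =
      LinearMap.transvection (LinearMap.fst F F W) (0, c) *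
        (LinearMap.prodMap 1 (D - b.smulRight c) *
          LinearMap.transvection (b ∘ₗ LinearMap.snd F F W) (1, 0)) := by
    refine LinearMap.ext fun x => ?_
    ext <;> simp [blockEnd_apply, LinearMap.transvection.apply, add_smul]
    abel
  rw [h1, map_mul, map_mul, LinearMap.transvection.det, LinearMap.transvection.det,
    LinearMap.det_prodMap]
  simp

/-- The shear `(a, w) ↦ (a + θ w, w)` of `F × W`. -/
def shear (θ : W →ₗ[F] F) : (F × W) ≃ₗ[F] (F × W) where
  toFun x := (x.1 + θ x.2, x.2)
  invFun x := (x.1 - θ x.2, x.2)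
  map_add' x y := by ext <;> simp; abel
  map_smul' r x := by ext <;> simp [mul_add]
  left_inv x := by simp
  right_inv x := by simp

theorem conjRingEquiv_shear_blockEnd {θ : W →ₗ[F] F} (b : W →ₗ[F] F) {c : W} (hθ : θ c = 0)
    (D : End F W) : (shear θ).conjRingEquiv (blockEnd b c D) =
      blockEnd (b - θ + θ ∘ₗ D) c (D - θ.smulRight c) := by
  refine LinearMap.ext fun x => ?_
  rw [LinearEquiv.conjRingEquiv_apply_apply]
  ext <;> simp [shear, blockEnd_apply, hθ, sub_smul] <;> abel

theorem exists_blockEnd_of_ne_smul_one {V : Type*} [AddCommGroup V] [Module F V] {f : End F V}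
    (hf : ∀ a : F, f ≠ a • 1) : ∃ (U : Submodule F V) (e : V ≃ₗ[F] F × U)
      (b : U →ₗ[F] F) (c : U) (D : End F U),
      c ≠ 0 ∧ e.conjRingEquiv f = blockEnd b c D := by
  obtain ⟨x, hx⟩ : ∃ x, LinearIndependent F ![x, f x] := by
    by_contra! h
    obtain ⟨a, ha⟩ := LinearMap.exists_eq_smul_id_of_forall_notLinearIndependent h
    exact hf a ha
  rw [LinearIndependent.pair_iff] at hx
  have hxs : x ∉ Submodule.span F {f x - x} := by
    rw [Submodule.mem_span_singleton]
    rintro ⟨a, ha⟩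
    have h1 := hx (-(a + 1)) a (by rw [neg_smul, add_smul, one_smul, neg_add, ← sub_eq_zero.2 ha, smul_sub]; abel)
    have h2 : a = 0 := h1.2
    simp [h2] at h1
  obtain ⟨ψ, hψx, hψ⟩ := Submodule.exists_le_ker_of_notMem hxs
  set φ : V →ₗ[F] F := (ψ x)⁻¹ • ψ with hφ
  have hφx : φ x = 1 := by simp [hφ, hψx]
  have hφc : φ (f x - x) = 0 := by
    have : ψ (f x - x) = 0 := hψ (Submodule.mem_span_singleton_self _)
    rw [hφ, LinearMap.smul_apply, this, smul_zero]
  have hφfx : φ (f x) = 1 := by rwa [map_sub, hφx, sub_eq_zero] at hφc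
  let π : V →ₗ[F] LinearMap.ker φ := (LinearMap.id - φ.smulRight x).codRestrict _ fun v => by
    simp [hφx]
  have hπ : ∀ v, (π v : V) = v - φ v • x := fun v => rfl
  let e : V ≃ₗ[F] F × LinearMap.ker φ :=
    { φ.prod π with
      invFun := fun p => p.1 • x + p.2
      left_inv := fun v => by simp [hπ]
      right_inv := fun p => by
        have h2 : φ p.2 = 0 := p.2.2
        ext <;> simp [hπ, hφx, h2] }
  refine ⟨LinearMap.ker φ, e, φ ∘ₗ f ∘ₗ (LinearMap.ker φ).subtype, π (f x),
    π ∘ₗ f ∘ₗ (LinearMap.ker φ).subtype, ?_, ?_⟩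
  · intro h
    have h1 : f x - x = 0 := by
      have := hπ (f x)
      rw [h, hφfx, one_smul] at this
      simpa using this.symm
    have := hx 1 (-1) (by rw [one_smul, neg_one_smul, ← sub_eq_add_neg, ← neg_sub, h1, neg_zero])
    exact one_ne_zero this.1
  · refine LinearMap.ext fun p => ?_
    rw [LinearEquiv.conjRingEquiv_apply_apply]
    change (φ (f (p.1 • x + p.2)), π (f (p.1 • x + p.2))) = _
    rw [blockEnd_apply]
    simp [hφfx]

end

theorem isProdTwoUnipotent_of_det_eq_one {F : Type*} [Field F] {V : Type*} [AddCommGroup V]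
    [Module F V] [FiniteDimensional F V] {f : End F V} (hdet : f.det = 1)
    (hf : ∀ a : F, f ≠ a • 1) : IsProdTwoUnipotent f := by
  induction hn : finrank F V using Nat.strong_induction_on generalizing V with
  | _ n ih =>
    obtain ⟨W, e, b, c, D, hc, he⟩ := exists_blockEnd_of_ne_smul_one hf
    have hW : finrank F W < n := by
      have := e.finrank_eq
      rw [finrank_prod, finrank_self, hn] at this
      omega
    have hdetf : (blockEnd b c D).det = 1 := by
      rw [← he, ← hdet]
      exact LinearMap.det_conj f e
    suffices h : IsProdTwoUnipotent (blockEnd b c D) by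
      rw [← he] at h
      simpa using h.map e.conjRingEquiv.symm.toRingHom
    by_cases hS : ∀ a : F, D - b.smulRight c ≠ a • 1
    · exact isProdTwoUnipotent_blockEnd (ih _ hW (by rw [← det_blockEnd, hdetf]) hS rfl)
    push Not at hS
    obtain ⟨a, ha⟩ := hS
    have hdeta : a ^ finrank F W = 1 := by
      rw [det_blockEnd, ha, LinearMap.det_smul] at hdetf
      simpa using hdetf
    have hD : D = a • 1 + b.smulRight c := by rw [← ha, sub_add_cancel]
    by_cases hc' : Submodule.span F {c} = ⊤
    · have h1 : finrank F W = 1 := by rw [← finrank_top, ← hc', finrank_span_singleton hc]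
      rw [h1, pow_one] at hdeta
      refine isProdTwoUnipotent_blockEnd ⟨1, 1, by simp, by simp, ?_⟩
      rw [ha, hdeta, one_smul, one_mul]
    · obtain ⟨θ, hθ, hθc⟩ := Submodule.exists_le_ker_of_lt_top _ (lt_top_iff_ne_top.2 hc')
      have hθc : θ c = 0 := hθc (Submodule.mem_span_singleton_self c)
      have hconj := conjRingEquiv_shear_blockEnd b hθc D
      suffices h : IsProdTwoUnipotent ((shear θ).conjRingEquiv (blockEnd b c D)) by
        simpa using h.map (shear θ).conjRingEquiv.symm.toRingHom
      have hdet' : ((shear θ).conjRingEquiv (blockEnd b c D)).det = 1 := by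
        rw [← hdetf]
        exact LinearMap.det_conj (blockEnd b c D) (shear θ)
      rw [hconj] at hdet' ⊢
      refine isProdTwoUnipotent_blockEnd (ih _ hW (by rw [← det_blockEnd, hdet']) ?_ rfl)
      intro a' ha'
      obtain ⟨w, hw⟩ : ∃ w, θ w ≠ 0 := by
        by_contra! h
        exact hθ (LinearMap.ext h)
      have h1 : a • w - (a * θ w) • c = a' • w := by
        have := congr($ha' w)
        simp [hD, hθc, add_smul, sub_smul] at this
        rw [← this]
        abel
      have h2 : a = a' := by
        have := congrArg θ h1
        simpa [hθc, hw] using this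
      have ha0 : a ≠ 0 := by
        rintro rfl
        have h3 : finrank F W ≠ 0 := fun h => hc (finrank_zero_iff_forall_zero.1 h c)
        simp [h3] at hdeta
      simp [h2 ▸ ha0, h2, hw, hc] at h1

theorem Matrix.det_eq_one_of_sub_one_mul_self {F ι : Type*} [Field F] [Fintype ι] [DecidableEq ι]
    {U : Matrix ι ι F} (hU : (U - 1) * (U - 1) = 0) : U.det = 1 := by
  have h1 : IsNilpotent (1 - U) := ⟨2, by rw [← neg_sub, neg_sq, sq, hU]⟩
  have h2 := (Matrix.isNilpotent_charpoly_sub_pow_of_isNilpotent h1).eq_zero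
  have h3 := Matrix.eval_charpoly (1 - U) 1
  rw [sub_eq_zero.1 h2] at h3
  simpa using h3.symm

/-- **Length-4 problem in `GLₙ(F)`, four U2-matrices.**
Let `F` be a field and `n` a positive integer. A matrix `M ∈ GLₙ(F)` is a product of four
U2-matrices (matrices `U` with `(U - 1)² = 0`) if and only if `det M = 1`. -/
theorem stmt5 {F : Type*} [Field F] {n : ℕ} (hn : 0 < n)
    (M : Matrix (Fin n) (Fin n) F) (hM : IsUnit M) :
    (∃ U₁ U₂ U₃ U₄ : Matrix (Fin n) (Fin n) F,
        (U₁ - 1) * (U₁ - 1) = 0 ∧ (U₂ - 1) * (U₂ - 1) = 0 ∧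
        (U₃ - 1) * (U₃ - 1) = 0 ∧ (U₄ - 1) * (U₄ - 1) = 0 ∧
        M = U₁ * U₂ * U₃ * U₄) ↔
      M.det = 1 := by
  constructor
  · rintro ⟨U₁, U₂, U₃, U₄, h₁, h₂, h₃, h₄, rfl⟩
    simp [Matrix.det_eq_one_of_sub_one_mul_self h₁, Matrix.det_eq_one_of_sub_one_mul_self h₂,
      Matrix.det_eq_one_of_sub_one_mul_self h₃, Matrix.det_eq_one_of_sub_one_mul_self h₄]
  · intro hdet
    suffices h : ∃ A B : Matrix (Fin n) (Fin n) F,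
        IsProdTwoU2 A ∧ IsProdTwoU2 B ∧ M = A * B by
      obtain ⟨_, _, ⟨U₁, U₂, h₁, h₂, rfl⟩, ⟨U₃, U₄, h₃, h₄, rfl⟩, h⟩ := h
      exact ⟨U₁, U₂, U₃, U₄, h₁, h₂, h₃, h₄, by rw [h]; simp only [mul_assoc]⟩
    by_cases hs : ∃ c : F, M = c • 1
    · obtain ⟨c, rfl⟩ := hs
      rw [Matrix.det_smul, Matrix.det_one, mul_one, Fintype.card_fin] at hdet
      exact exists_smul_one_eq_mul_of_pow_eq_one hn hdet
    · push Not at hs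
      let e : Matrix (Fin n) (Fin n) F ≃ₐ[F] End F (Fin n → F) := Matrix.toLinAlgEquiv'
      obtain ⟨A, B, hA, hB, hAB⟩ : IsProdTwoUnipotent (e M) := by
        refine isProdTwoUnipotent_of_det_eq_one ?_ fun a ha => hs a (e.injective ?_)
        · rw [← hdet]
          exact LinearMap.det_toLin' M
        · rw [ha, map_smul, map_one]
      refine ⟨e.symm A, e.symm B,
        (isProdTwoU2_of_isNilpotent hA).map e.symm.toAlgHom.toRingHom,
        (isProdTwoU2_of_isNilpotent hB).map e.symm.toAlgHom.toRingHom, ?_⟩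
      rw [← map_mul, ← hAB, AlgEquiv.symm_apply_apply]
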